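/- Let P and Q be weakly compact convex sets of probability measures on a Polish space X. Then the generalized KL divergence satisfies the duality formula: sup_{μ∈P} inf_{ν∈Q} KL(μ‖ν) = sup over bounded continuous φ of ( sup_{μ∈P} E_μ[φ] − log( sup_{ν∈Q} E_ν[e^φ] ) ). -/

import Mathlib

open MeasureTheory Real ENNReal Filter Topology
open scoped Classical

noncomputable def klDiv {X : Type*} [MeasurableSpace X] (μ ν : Measure X) : EReal :=
  if μ ≪ ν ∧ Integrable (fun x => Real.log (μ.rnDeriv ν x).toReal) μ
  then ((∫ x, Real.log (μ.rnDeriv ν x).toReal ∂μ : ℝ) : EReal)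
  else ⊤

noncomputable def tvDist {X : Type*} [MeasurableSpace X] (μ ν : Measure X) : ℝ :=
  ⨆ A : {A : Set X // MeasurableSet A}, |(μ A).toReal - (ν A).toReal|


noncomputable def genKL {X : Type*} [MeasurableSpace X]
    (P Q : Set (ProbabilityMeasure X)) : EReal :=
  ⨆ μ ∈ P, ⨅ ν ∈ Q, klDiv μ.toMeasure ν.toMeasure

noncomputable def genV {X : Type*} [MeasurableSpace X]
    (P Q : Set (ProbabilityMeasure X)) : ℝ :=
  max (⨆ μ : P, ⨅ ν : Q, tvDist μ.1.toMeasure ν.1.toMeasure)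
      (⨆ ν : Q, ⨅ μ : P, tvDist μ.1.toMeasure ν.1.toMeasure)

def ConvexPM {X : Type*} [MeasurableSpace X] (P : Set (ProbabilityMeasure X)) : Prop :=
  ∀ μ ∈ P, ∀ ν ∈ P, ∀ a b : ℝ≥0∞, a + b = 1 →
    ∃ κ ∈ P, κ.toMeasure = a • μ.toMeasure + b • ν.toMeasure

def midSet {X : Type*} [MeasurableSpace X]
    (P Q : Set (ProbabilityMeasure X)) : Set (ProbabilityMeasure X) :=
  {κ | ∃ μ ∈ P, ∃ ν ∈ Q, κ.toMeasure = (2:ℝ≥0∞)⁻¹ • μ.toMeasure + (2:ℝ≥0∞)⁻¹ • ν.toMeasure}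

noncomputable def genJS {X : Type*} [MeasurableSpace X]
    (P Q : Set (ProbabilityMeasure X)) : EReal :=
  ((1/2 : ℝ) : EReal) * genKL P (midSet P Q) + ((1/2 : ℝ) : EReal) * genKL Q (midSet P Q)


/-- Gibbs / easy half of Donsker-Varadhan. -/
lemma dv_le {X : Type*} [MeasurableSpace X] [TopologicalSpace X] [BorelSpace X]
    (μ ν : Measure X) [IsProbabilityMeasure μ] [IsProbabilityMeasure ν]
    (φ : BoundedContinuousFunction X ℝ) (he : Integrable (fun x => Real.exp (φ x)) ν) :
    ((∫ x, φ x ∂μ - Real.log (∫ x, Real.exp (φ x) ∂ν) : ℝ) : EReal) ≤ klDiv μ ν := by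
  unfold klDiv
  split_ifs with h
  · obtain ⟨hac, hint⟩ := h
    have hint' : Integrable (llr μ ν) μ := hint
    have h1 := integral_llr_tilted_right hac (φ.integrable μ) he hint'
    have : IsProbabilityMeasure (ν.tilted φ) := isProbabilityMeasure_tilted he
    have hac2 : μ ≪ ν.tilted φ := hac.trans (absolutelyContinuous_tilted he)
    have h2 := InformationTheory.integral_llr_add_sub_measure_univ_nonneg hac2
      (integrable_llr_tilted_right hac (φ.integrable μ) hint' he)
    simp only [measureReal_def, measure_univ, ENNReal.toReal_one] at h2
    rw [EReal.coe_le_coe_iff]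
    have h3 : ∫ x, llr μ ν x ∂μ = ∫ x, Real.log (μ.rnDeriv ν x).toReal ∂μ := rfl
    linarith
  · exact le_top

/-- extension from bounded continuous to bounded measurable test functions. -/
lemma dv_ext {X : Type*} [MeasurableSpace X] [TopologicalSpace X] [PolishSpace X]
    [BorelSpace X] (μ ν : Measure X) [IsProbabilityMeasure μ] [IsProbabilityMeasure ν] (C : ℝ)
    (h : ∀ φ : BoundedContinuousFunction X ℝ,
      Real.exp (∫ x, φ x ∂μ - C) ≤ ∫ x, Real.exp (φ x) ∂ν)
    (φ : X → ℝ) (hφ : Measurable φ) (n : ℝ) (hn : ∀ x, |φ x| ≤ n) :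
    Real.exp (∫ x, φ x ∂μ - C) ≤ ∫ x, Real.exp (φ x) ∂ν := by
  let _ := TopologicalSpace.upgradeIsCompletelyMetrizable X
  have hn0 : 0 ≤ n := by
    obtain ⟨x⟩ := nonempty_of_isProbabilityMeasure μ
    exact (abs_nonneg _).trans (hn x)
  have hint : ∀ (m : Measure X) [IsFiniteMeasure m], ∀ g : X → ℝ, Measurable g →
      (∀ x, |g x| ≤ n) → Integrable g m := fun m _ g hg hb =>
    Integrable.of_bound hg.aestronglyMeasurable n (Eventually.of_forall fun x => by simpa using hb x)
  have hinte : ∀ (m : Measure X) [IsFiniteMeasure m], ∀ g : X → ℝ, Measurable g →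
      (∀ x, |g x| ≤ n) → Integrable (fun x => Real.exp (g x)) m := fun m _ g hg hb =>
    Integrable.of_bound hg.exp.aestronglyMeasurable (Real.exp n) (Eventually.of_forall fun x => by
      simpa using (le_abs_self _).trans (hb x))
  have key : ∀ ε > 0, Real.exp (∫ x, φ x ∂μ - ε - C) ≤
      ∫ x, Real.exp (φ x) ∂ν + Real.exp n * ε := by
    intro ε hε
    obtain ⟨g, hg, hgi⟩ := (hint (μ + ν) φ hφ hn).exists_boundedContinuous_integral_sub_le hε
    let ψ : BoundedContinuousFunction X ℝ := BoundedContinuousFunction.ofNormedAddCommGroup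
      (fun x => max (-n) (min n (g x))) (by fun_prop) n (by
        intro x
        rw [Real.norm_eq_abs, abs_le]
        exact ⟨le_max_left _ _, max_le (by linarith) (min_le_left _ _)⟩)
    have hψ : ∀ x, ψ x = max (-n) (min n (g x)) := fun x => rfl
    have hψn : ∀ x, |ψ x| ≤ n := by
      intro x
      rw [hψ, abs_le]
      exact ⟨le_max_left _ _, max_le (by linarith) (min_le_left _ _)⟩
    have hψm : Measurable ψ := ψ.continuous.measurable
    have hcl : ∀ x, |φ x - ψ x| ≤ ‖φ x - g x‖ := by
      intro x
      have := abs_le.1 (hn x)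
      rw [hψ, Real.norm_eq_abs]
      rcases le_total n (g x) with h1 | h1
      · rw [min_eq_left h1, max_eq_right (by linarith), abs_sub_comm, abs_sub_comm (φ x),
          abs_of_nonneg, abs_of_nonneg] <;> linarith
      · rw [min_eq_right h1]
        rcases le_total (-n) (g x) with h2 | h2
        · rw [max_eq_right h2]
        · rw [max_eq_left h2, abs_of_nonneg, abs_of_nonneg] <;> linarith
    have hsub : ∀ (m : Measure X) [IsFiniteMeasure m], Integrable (fun x => |φ x - ψ x|) m :=
      fun m _ => ((hint m φ hφ hn).sub (hint m ψ hψm hψn)).abs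
    have htot : ∫ x, |φ x - ψ x| ∂(μ + ν) ≤ ε :=
      (integral_mono (hsub _) ((hint _ φ hφ hn).sub hgi).norm hcl).trans hg
    rw [integral_add_measure (hsub μ) (hsub ν)] at htot
    have p1 : 0 ≤ ∫ x, |φ x - ψ x| ∂μ := integral_nonneg fun _ => abs_nonneg _
    have p2 : 0 ≤ ∫ x, |φ x - ψ x| ∂ν := integral_nonneg fun _ => abs_nonneg _
    have e1 : ∫ x, φ x ∂μ - ∫ x, ψ x ∂μ ≤ ε := by
      rw [← integral_sub (hint μ φ hφ hn) (hint μ ψ hψm hψn)]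
      refine (integral_mono ((hint μ φ hφ hn).sub (hint μ ψ hψm hψn)) (hsub μ)
        (fun x => le_abs_self _)).trans (by linarith)
    have e2 : ∫ x, Real.exp (ψ x) ∂ν - ∫ x, Real.exp (φ x) ∂ν ≤ Real.exp n * ε := by
      rw [← integral_sub (hinte ν ψ hψm hψn) (hinte ν φ hφ hn)]
      calc _ ≤ ∫ x, Real.exp n * |φ x - ψ x| ∂ν := by
            refine integral_mono ((hinte ν ψ hψm hψn).sub (hinte ν φ hφ hn))
              ((hsub ν).const_mul _) fun x => ?_
            have a1 := Real.add_one_le_exp (φ x - ψ x)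
            have a2 : Real.exp (φ x) = Real.exp (ψ x) * Real.exp (φ x - ψ x) := by
              rw [← Real.exp_add]; ring_nf
            have a3 : Real.exp (ψ x) ≤ Real.exp n :=
              Real.exp_le_exp.2 ((le_abs_self _).trans (hψn x))
            have a4 := Real.exp_pos (ψ x)
            have a5 := neg_abs_le (φ x - ψ x)
            have a6 := abs_nonneg (φ x - ψ x)
            show Real.exp (ψ x) - Real.exp (φ x) ≤ _
            rw [a2]
            nlinarith
        _ = Real.exp n * ∫ x, |φ x - ψ x| ∂ν := integral_const_mul _ _
        _ ≤ _ := by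
            have := Real.exp_pos n
            nlinarith
    have := h ψ
    have e3 : Real.exp (∫ x, φ x ∂μ - ε - C) ≤ Real.exp (∫ x, ψ x ∂μ - C) :=
      Real.exp_le_exp.2 (by linarith)
    linarith
  have t1 : Tendsto (fun ε : ℝ => Real.exp (∫ x, φ x ∂μ - ε - C)) (𝓝[>] 0)
      (𝓝 (Real.exp (∫ x, φ x ∂μ - 0 - C))) :=
    (Continuous.tendsto (by fun_prop) 0).mono_left nhdsWithin_le_nhds
  have t2 : Tendsto (fun ε : ℝ => ∫ x, Real.exp (φ x) ∂ν + Real.exp n * ε) (𝓝[>] 0)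
      (𝓝 (∫ x, Real.exp (φ x) ∂ν + Real.exp n * 0)) :=
    (Continuous.tendsto (by fun_prop) 0).mono_left nhdsWithin_le_nhds
  have := le_of_tendsto_of_tendsto t1 t2 (by
    filter_upwards [self_mem_nhdsWithin] with ε hε using key ε hε)
  simpa using this

/-- hard half of Donsker-Varadhan. -/
lemma dv_ge {X : Type*} [MeasurableSpace X] [TopologicalSpace X] [PolishSpace X]
    [BorelSpace X] (μ ν : Measure X) [IsProbabilityMeasure μ] [IsProbabilityMeasure ν] (C : ℝ)
    (h : ∀ φ : BoundedContinuousFunction X ℝ,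
      Real.exp (∫ x, φ x ∂μ - C) ≤ ∫ x, Real.exp (φ x) ∂ν) :
    klDiv μ ν ≤ (C : EReal) := by
  have hm := dv_ext μ ν C h
  have hC : 0 ≤ C := by
    have := h 0
    simp at this
    exact this
  have hac : μ ≪ ν := by
    refine Measure.AbsolutelyContinuous.mk fun A hA hνA => ?_
    have hb : ∀ k : ℕ, (k : ℝ) * μ.real A ≤ C := by
      intro k
      have h1 := hm (A.indicator fun _ => (k : ℝ)) (measurable_const.indicator hA) k (by
        intro x
        by_cases hx : x ∈ A <;> simp [hx])
      have h2 : ∫ x, Real.exp (A.indicator (fun _ => (k : ℝ)) x) ∂ν = 1 := by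
        have : (fun x => Real.exp (A.indicator (fun _ => (k : ℝ)) x)) =ᵐ[ν] fun _ => 1 := by
          filter_upwards [measure_eq_zero_iff_ae_notMem.1 hνA] with x hx
          simp [hx]
        rw [integral_congr_ae this]; simp
      rw [h2, integral_indicator_const _ hA, Real.exp_le_one_iff, smul_eq_mul] at h1
      linarith
    have h0 : μ.real A = 0 := by
      by_contra hne
      have hpos : 0 < μ.real A := lt_of_le_of_ne measureReal_nonneg (Ne.symm hne)
      obtain ⟨k, hk⟩ := exists_nat_gt (C / μ.real A)
      rw [div_lt_iff₀ hpos] at hk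
      linarith [hb k]
    exact (measureReal_eq_zero_iff).1 h0
  set f : X → ℝ := fun x => (μ.rnDeriv ν x).toReal with hf
  have hfm : Measurable f := (Measure.measurable_rnDeriv μ ν).ennreal_toReal
  have hf0 : ∀ x, 0 ≤ f x := fun x => ENNReal.toReal_nonneg
  let z : ℕ → X → ℝ := fun n x => max (1 / ((n : ℝ) + 1)) (min ((n : ℝ) + 1) (f x))
  have hzm : ∀ n, Measurable (z n) := fun n => by
    exact measurable_const.max (measurable_const.min hfm)
  have hz0 : ∀ n x, 0 < z n x := fun n x => lt_of_lt_of_le (by positivity) (le_max_left _ _)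
  have hzu : ∀ n x, z n x ≤ (n : ℝ) + 1 := fun n x => by
    refine max_le ?_ (min_le_left _ _)
    have hn : (0 : ℝ) ≤ n := Nat.cast_nonneg n
    rw [div_le_iff₀ (by positivity)]
    nlinarith
  have hzb : ∀ n x, |Real.log (z n x)| ≤ Real.log ((n : ℝ) + 1) := by
    intro n x
    rw [abs_le]
    constructor
    · rw [← Real.log_inv]
      apply Real.log_le_log (by positivity)
      rw [← one_div]; exact le_max_left _ _
    · exact Real.log_le_log (hz0 n x) (hzu n x)
  let g : ℕ → X → ℝ := fun n x => f x * Real.log (z n x) - z n x + 1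
  have hgm : ∀ n, Measurable (g n) := fun n =>
    ((hfm.mul (hzm n).log).sub (hzm n)).add_const 1
  have hg0 : ∀ n x, 0 ≤ g n x := by
    intro n x
    have h1 := InformationTheory.klFun_nonneg (hz0 n x).le
    rw [InformationTheory.klFun] at h1
    have h2 : 0 ≤ (f x - z n x) * Real.log (z n x) := by
      have hn : (0 : ℝ) ≤ n := Nat.cast_nonneg n
      have ha1 : 1 / ((n : ℝ) + 1) ≤ 1 := by
        rw [div_le_iff₀ (by positivity)]; linarith
      have hzd : z n x = max (1 / ((n : ℝ) + 1)) (min ((n : ℝ) + 1) (f x)) := rfl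
      rcases le_total (f x) (1 / ((n : ℝ) + 1)) with hl | hl
      · have e : z n x = 1 / ((n : ℝ) + 1) := by
          rw [hzd, max_eq_left ((min_le_right _ _).trans hl)]
        refine mul_nonneg_of_nonpos_of_nonpos (by linarith)
          (Real.log_nonpos (hz0 n x).le (by linarith))
      · rcases le_total (f x) ((n : ℝ) + 1) with hu | hu
        · have e : z n x = f x := by
            rw [hzd, min_eq_right hu, max_eq_right hl]
          simp [e]
        · have e : z n x = (n : ℝ) + 1 := by
            rw [hzd, min_eq_left hu, max_eq_right (by linarith)]
          exact mul_nonneg (by linarith) (Real.log_nonneg (by linarith))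
    show 0 ≤ f x * Real.log (z n x) - z n x + 1
    nlinarith
  have hfi : Integrable f ν := Measure.integrable_toReal_rnDeriv
  have hzi : ∀ n, Integrable (z n) ν := fun n =>
    Integrable.of_bound (hzm n).aestronglyMeasurable ((n : ℝ) + 1) (Eventually.of_forall fun x => by
      rw [Real.norm_eq_abs, abs_of_pos (hz0 n x)]; exact hzu n x)
  have hfl : ∀ n, Integrable (fun x => f x * Real.log (z n x)) ν := fun n =>
    hfi.mul_bdd (c := Real.log ((n : ℝ) + 1)) (hzm n).log.aestronglyMeasurable
      (Eventually.of_forall fun x => by simpa using hzb n x)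
  have hgi : ∀ n, Integrable (g n) ν := fun n => ((hfl n).sub (hzi n)).add (integrable_const 1)
  have hgI : ∀ n, ∫ x, g n x ∂ν ≤ C := by
    intro n
    have h1 : ∫ x, g n x ∂ν = ∫ x, Real.log (z n x) ∂μ - ∫ x, z n x ∂ν + 1 := by
      have e1 : ∫ x, g n x ∂ν = ∫ x, (f x * Real.log (z n x) - z n x) ∂ν + ∫ x, (1 : ℝ) ∂ν :=
        integral_add ((hfl n).sub (hzi n)) (integrable_const 1)
      have e2 : ∫ x, f x * Real.log (z n x) ∂ν = ∫ x, Real.log (z n x) ∂μ :=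
        integral_rnDeriv_smul hac
      rw [e1, integral_sub (hfl n) (hzi n), e2]
      simp
    have h2 := hm (fun x => Real.log (z n x)) (hzm n).log _ (hzb n)
    have h3 : ∫ x, Real.exp (Real.log (z n x)) ∂ν = ∫ x, z n x ∂ν :=
      integral_congr_ae (Eventually.of_forall fun x => Real.exp_log (hz0 n x))
    rw [h3] at h2
    have h4 := Real.add_one_le_exp (∫ x, Real.log (z n x) ∂μ - C)
    linarith
  have hlim : ∀ x, Tendsto (fun n => g n x) atTop (𝓝 (InformationTheory.klFun (f x))) := by
    intro x
    have t0 : Tendsto (fun n : ℕ => 1 / ((n : ℝ) + 1)) atTop (𝓝 0) :=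
      tendsto_one_div_add_atTop_nhds_zero_nat
    have t1 : Tendsto (fun n => z n x) atTop (𝓝 (f x)) := by
      have t2 : Tendsto (fun n : ℕ => min ((n : ℝ) + 1) (f x)) atTop (𝓝 (f x)) := by
        refine tendsto_const_nhds.congr' ?_
        obtain ⟨N, hN⟩ := exists_nat_gt (f x)
        filter_upwards [eventually_ge_atTop N] with n hn
        have : (N : ℝ) ≤ n := by exact_mod_cast hn
        rw [min_eq_right]; linarith
      have := t0.max t2
      rwa [max_eq_right (hf0 x)] at this
    have e : InformationTheory.klFun (f x) = f x * Real.log (f x) - f x + 1 := by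
      rw [InformationTheory.klFun]; ring
    rw [e]
    refine Tendsto.add_const 1 (Tendsto.sub ?_ t1)
    rcases eq_or_lt_of_le (hf0 x) with h0 | h0
    · simp [← h0]
    · exact (t1.log h0.ne').const_mul _
  have hkl : InformationTheory.klDiv μ ν ≤ ENNReal.ofReal C := by
    rw [InformationTheory.klDiv_eq_lintegral_klFun_of_ac hac]
    calc ∫⁻ x, ENNReal.ofReal (InformationTheory.klFun (f x)) ∂ν
        = ∫⁻ x, liminf (fun n => ENNReal.ofReal (g n x)) atTop ∂ν := by
          refine lintegral_congr fun x => ?_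
          exact ((ENNReal.continuous_ofReal.tendsto _).comp (hlim x)).liminf_eq.symm
      _ ≤ liminf (fun n => ∫⁻ x, ENNReal.ofReal (g n x) ∂ν) atTop :=
          lintegral_liminf_le fun n => (hgm n).ennreal_ofReal
      _ ≤ liminf (fun n : ℕ => ENNReal.ofReal C) atTop := by
          refine liminf_le_liminf (Eventually.of_forall fun n => ?_)
          rw [← ofReal_integral_eq_lintegral_ofReal (hgi n) (Eventually.of_forall (hg0 n))]
          exact ENNReal.ofReal_le_ofReal (hgI n)
      _ = ENNReal.ofReal C := by simp
  have hne : InformationTheory.klDiv μ ν ≠ ∞ := ne_top_of_le_ne_top ENNReal.ofReal_ne_top hkl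
  have h3 := InformationTheory.klDiv_ne_top_iff.1 hne
  have h4 := InformationTheory.toReal_klDiv_of_measure_eq hac (by simp : μ Set.univ = ν Set.univ)
  unfold klDiv
  rw [if_pos (show μ ≪ ν ∧ Integrable (fun x => Real.log (μ.rnDeriv ν x).toReal) μ from h3),
    EReal.coe_le_coe_iff]
  have h5 := ENNReal.toReal_mono ENNReal.ofReal_ne_top hkl
  rw [h4, ENNReal.toReal_ofReal hC] at h5
  exact h5


lemma sion_step {X : Type*} [MeasurableSpace X] [TopologicalSpace X] [PolishSpace X]
    [BorelSpace X] (Q : Set (ProbabilityMeasure X)) (hQne : Q.Nonempty) (hQc : IsCompact Q)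
    (hQconv : ConvexPM Q) (μ : Measure X) [IsProbabilityMeasure μ] (C C' : ℝ) (hC : C < C')
    (h : ∀ φ : BoundedContinuousFunction X ℝ, ∃ ν ∈ Q,
      Real.exp (∫ x, φ x ∂μ - C) ≤ ∫ x, Real.exp (φ x) ∂ν.toMeasure) :
    ∃ ν ∈ Q, ∀ φ : BoundedContinuousFunction X ℝ,
      Real.exp (∫ x, φ x ∂μ - C') ≤ ∫ x, Real.exp (φ x) ∂ν.toMeasure := by
  let T : ProbabilityMeasure X → (BoundedContinuousFunction X ℝ → ℝ) :=
    fun ν g => ∫ x, g x ∂ν.toMeasure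
  have hT : Continuous T := continuous_pi fun g =>
    ProbabilityMeasure.continuous_integral_boundedContinuousFunction g
  let ex : BoundedContinuousFunction X ℝ → BoundedContinuousFunction X ℝ := fun φ =>
    BoundedContinuousFunction.ofNormedAddCommGroup (fun x => Real.exp (φ x - ∫ y, φ y ∂μ))
      (by fun_prop) (Real.exp (‖φ‖ - ∫ y, φ y ∂μ)) (by
        intro x
        rw [Real.norm_eq_abs, abs_of_pos (Real.exp_pos _), Real.exp_le_exp]
        linarith [(le_abs_self _).trans (φ.norm_coe_le_norm x)])
  have hex : ∀ φ x, ex φ x = Real.exp (φ x - ∫ y, φ y ∂μ) := fun _ _ => rfl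
  let F : (BoundedContinuousFunction X ℝ → ℝ) → BoundedContinuousFunction X ℝ → EReal :=
    fun L φ => ((-(L (ex φ)) : ℝ) : EReal)
  have hmono : Monotone (fun r : ℝ => (r : EReal)) := EReal.coe_strictMono.monotone
  have hconv : Convex ℝ (T '' Q) := by
    rintro _ ⟨ν₁, h1, rfl⟩ _ ⟨ν₂, h2, rfl⟩ a b ha hb hab
    obtain ⟨κ, hκ, hκe⟩ := hQconv ν₁ h1 ν₂ h2 (ENNReal.ofReal a) (ENNReal.ofReal b) (by
      rw [← ENNReal.ofReal_add ha hb, hab, ENNReal.ofReal_one])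
    refine ⟨κ, hκ, funext fun g => ?_⟩
    show ∫ x, g x ∂κ.toMeasure = a * ∫ x, g x ∂ν₁.toMeasure + b * ∫ x, g x ∂ν₂.toMeasure
    rw [hκe, integral_add_measure ((g.integrable _).smul_measure ENNReal.ofReal_ne_top)
      ((g.integrable _).smul_measure ENNReal.ofReal_ne_top), integral_smul_measure,
      integral_smul_measure, ENNReal.toReal_ofReal ha, ENNReal.toReal_ofReal hb]
    rfl
  have hintc : ∀ (m : Measure X) [IsProbabilityMeasure m],
      Continuous fun φ : BoundedContinuousFunction X ℝ => ∫ x, φ x ∂m := by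
    intro m _
    rw [continuous_iff_continuousAt]
    intro φ₀
    refine continuousAt_of_dominated (bound := fun _ => ‖φ₀‖ + 1)
      (Eventually.of_forall fun φ => (φ.integrable m).aestronglyMeasurable) ?_
      (integrable_const _) (Eventually.of_forall fun x => ?_)
    · filter_upwards [(continuous_norm.tendsto φ₀).eventually (gt_mem_nhds (lt_add_one ‖φ₀‖))]
        with φ hφ
      exact Eventually.of_forall fun x => (φ.norm_coe_le_norm x).trans hφ.le
    · exact (continuous_eval_const (F := BoundedContinuousFunction X ℝ) x).continuousAt
  have hintm : ∀ ν : ProbabilityMeasure X,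
      Continuous fun φ : BoundedContinuousFunction X ℝ => ∫ x, ex φ x ∂ν.toMeasure := by
    intro ν
    rw [continuous_iff_continuousAt]
    intro φ₀
    refine continuousAt_of_dominated (bound := fun _ => Real.exp (‖φ₀‖ + 1 - (∫ x, φ₀ x ∂μ - 1)))
      (Eventually.of_forall fun φ => ((ex φ).integrable _).aestronglyMeasurable) ?_
      (integrable_const _) (Eventually.of_forall fun x => ?_)
    · filter_upwards [(continuous_norm.tendsto φ₀).eventually (gt_mem_nhds (lt_add_one ‖φ₀‖)),
        ((hintc μ).tendsto φ₀).eventually (lt_mem_nhds (sub_one_lt (∫ x, φ₀ x ∂μ)))]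
        with φ hφ hφ2
      refine Eventually.of_forall fun x => ?_
      rw [hex, Real.norm_eq_abs, abs_of_pos (Real.exp_pos _), Real.exp_le_exp]
      linarith [(le_abs_self _).trans (φ.norm_coe_le_norm x)]
    · simp only [hex]
      exact (Real.continuous_exp.comp
        ((continuous_eval_const (F := BoundedContinuousFunction X ℝ) x).sub (hintc μ))).continuousAt
  have key := Sion.minimax' (X := T '' Q) (Y := Set.univ) (f := F) (hQne.image T) hconv
    (hQc.image hT)
    (by
      intro φ _
      have : Continuous fun L : BoundedContinuousFunction X ℝ → ℝ => F L φ :=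
        continuous_coe_real_ereal.comp (continuous_apply (ex φ)).neg
      exact this.lowerSemicontinuous.lowerSemicontinuousOn _)
    (by
      intro φ _
      refine QuasiconvexOn.monotone_comp (f := fun L : BoundedContinuousFunction X ℝ → ℝ =>
        -(L (ex φ))) hmono (ConvexOn.quasiconvexOn ⟨hconv, ?_⟩)
      intro L _ M _ a b _ _ _
      simp only [Pi.add_apply, Pi.smul_apply, smul_eq_mul]
      linarith)
    convex_univ
    (by
      rintro _ ⟨ν, _, rfl⟩
      have : Continuous fun φ : BoundedContinuousFunction X ℝ => F (T ν) φ :=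
        continuous_coe_real_ereal.comp (hintm ν).neg
      exact this.upperSemicontinuous.upperSemicontinuousOn _)
    (by
      rintro _ ⟨ν, _, rfl⟩
      refine QuasiconcaveOn.monotone_comp (f := fun φ : BoundedContinuousFunction X ℝ =>
        -(∫ x, ex φ x ∂ν.toMeasure)) hmono (ConcaveOn.quasiconcaveOn ⟨convex_univ, ?_⟩)
      intro φ _ ψ _ a b ha hb hab
      have e : ∫ x, ex (a • φ + b • ψ) x ∂ν.toMeasure ≤
          ∫ x, (a * ex φ x + b * ex ψ x) ∂ν.toMeasure := by
        refine integral_mono ((ex _).integrable _) ((((ex φ).integrable _).const_mul a).add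
          (((ex ψ).integrable _).const_mul b)) fun x => ?_
        simp only [hex]
        have e1 : ∫ y, (a • φ + b • ψ) y ∂μ = a * ∫ y, φ y ∂μ + b * ∫ y, ψ y ∂μ := by
          simp only [BoundedContinuousFunction.coe_add, BoundedContinuousFunction.coe_smul,
            Pi.add_apply, smul_eq_mul]
          rw [integral_add ((φ.integrable _).const_mul a) ((ψ.integrable _).const_mul b),
            integral_const_mul, integral_const_mul]
        rw [e1]
        have e2 := convexOn_exp.2 (Set.mem_univ (φ x - ∫ y, φ y ∂μ))
          (Set.mem_univ (ψ x - ∫ y, ψ y ∂μ)) ha hb hab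
        simp only [smul_eq_mul] at e2
        refine le_trans (le_of_eq ?_) e2
        congr 1
        simp only [BoundedContinuousFunction.coe_add, BoundedContinuousFunction.coe_smul,
            Pi.add_apply, smul_eq_mul]
        ring
      rw [integral_add (((ex φ).integrable _).const_mul a) (((ex ψ).integrable _).const_mul b),
            integral_const_mul, integral_const_mul] at e
      simp only [smul_eq_mul]
      linarith)
  have hfac : ∀ (φ : BoundedContinuousFunction X ℝ) (ν : ProbabilityMeasure X),
      ∫ x, ex φ x ∂ν.toMeasure =
        (∫ x, Real.exp (φ x) ∂ν.toMeasure) * Real.exp (- ∫ x, φ x ∂μ) := by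
    intro φ ν
    rw [← integral_mul_const]
    simp only [hex, sub_eq_add_neg, Real.exp_add]
  have hequiv : ∀ (φ : BoundedContinuousFunction X ℝ) (ν : ProbabilityMeasure X) (D : ℝ),
      Real.exp (∫ x, φ x ∂μ - D) ≤ ∫ x, Real.exp (φ x) ∂ν.toMeasure ↔
        F (T ν) φ ≤ ((-Real.exp (-D) : ℝ) : EReal) := by
    intro φ ν D
    show _ ↔ ((-(∫ x, ex φ x ∂ν.toMeasure) : ℝ) : EReal) ≤ _
    rw [EReal.coe_le_coe_iff, neg_le_neg_iff, hfac, Real.exp_neg (∫ x, φ x ∂μ), ← div_eq_mul_inv,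
      le_div_iff₀ (Real.exp_pos _), ← Real.exp_add, neg_add_eq_sub]
  have hle : ⨆ φ ∈ (Set.univ : Set (BoundedContinuousFunction X ℝ)), ⨅ L ∈ T '' Q, F L φ
      ≤ ((-Real.exp (-C) : ℝ) : EReal) := by
    refine iSup₂_le fun φ _ => ?_
    obtain ⟨ν, hν, hh⟩ := h φ
    exact (iInf₂_le (T ν) ⟨ν, hν, rfl⟩).trans ((hequiv φ ν C).1 hh)
  rw [← key] at hle
  have hlt : ((-Real.exp (-C) : ℝ) : EReal) < ((-Real.exp (-C') : ℝ) : EReal) := by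
    rw [EReal.coe_lt_coe_iff, neg_lt_neg_iff, Real.exp_lt_exp]; linarith
  have hlt2 := hle.trans_lt hlt
  simp only [iInf_lt_iff] at hlt2
  obtain ⟨_, ⟨ν, hν, rfl⟩, hh⟩ := hlt2
  refine ⟨ν, hν, fun φ => (hequiv φ ν C').2 ?_⟩
  exact (le_iSup₂ (f := fun φ (_ : φ ∈ (Set.univ : Set (BoundedContinuousFunction X ℝ))) =>
    F (T ν) φ) φ (Set.mem_univ φ)).trans hh.le

theorem genKL_duality {X : Type*} [MeasurableSpace X] [TopologicalSpace X] [PolishSpace X]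
    [BorelSpace X] (P Q : Set (ProbabilityMeasure X))
    (hPne : P.Nonempty) (hQne : Q.Nonempty) (hPc : IsCompact P) (hQc : IsCompact Q)
    (hPconv : ConvexPM P) (hQconv : ConvexPM Q) :
    genKL P Q =
      ⨆ φ : BoundedContinuousFunction X ℝ,
        (((⨆ μ : P, ∫ x, φ x ∂μ.1.toMeasure)
          - Real.log (⨆ ν : Q, ∫ x, Real.exp (φ x) ∂ν.1.toMeasure) : ℝ) : EReal) := by
  have hexi : ∀ (φ : BoundedContinuousFunction X ℝ) (ν : ProbabilityMeasure X),
      Integrable (fun x => Real.exp (φ x)) ν.toMeasure := fun φ ν =>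
    Integrable.of_bound (φ.continuous.measurable.exp).aestronglyMeasurable (Real.exp ‖φ‖)
      (Eventually.of_forall fun x => by
        simpa using (le_abs_self _).trans (φ.norm_coe_le_norm x))
  have hexpos : ∀ (φ : BoundedContinuousFunction X ℝ) (ν : ProbabilityMeasure X),
      0 < ∫ x, Real.exp (φ x) ∂ν.toMeasure := fun φ ν => integral_exp_pos (hexi φ ν)
  have hbQ : ∀ φ : BoundedContinuousFunction X ℝ,
      BddAbove (Set.range fun ν : Q => ∫ x, Real.exp (φ x) ∂ν.1.toMeasure) := by
    intro φ
    refine ⟨Real.exp ‖φ‖, ?_⟩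
    rintro _ ⟨ν, rfl⟩
    refine (integral_mono (hexi φ ν.1) (integrable_const (Real.exp ‖φ‖)) fun x => ?_).trans
      (by simp)
    exact Real.exp_le_exp.2 ((le_abs_self _).trans (φ.norm_coe_le_norm x))
  have hbP : ∀ φ : BoundedContinuousFunction X ℝ,
      BddAbove (Set.range fun μ : P => ∫ x, φ x ∂μ.1.toMeasure) := by
    intro φ
    refine ⟨‖φ‖, ?_⟩
    rintro _ ⟨ν, rfl⟩
    refine (integral_mono (φ.integrable _) (integrable_const ‖φ‖) fun x => ?_).trans
      (by simp)
    exact (le_abs_self _).trans (φ.norm_coe_le_norm x)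
  have : Nonempty P := hPne.to_subtype
  have : Nonempty Q := hQne.to_subtype
  apply le_antisymm
  · refine iSup₂_le fun μ hμ => ?_
    by_contra hcon
    rw [not_le] at hcon
    obtain ⟨C, hC1, hC2⟩ := EReal.lt_iff_exists_real_btwn.1 hcon
    obtain ⟨C', hC1', hC2'⟩ := EReal.lt_iff_exists_real_btwn.1 hC2
    rw [EReal.coe_lt_coe_iff] at hC1'
    obtain ⟨ν, hν, hall⟩ := sion_step Q hQne hQc hQconv μ.toMeasure C C' hC1' (by
      intro φ
      have h1 := (le_iSup (fun φ : BoundedContinuousFunction X ℝ =>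
        (((⨆ μ : P, ∫ x, φ x ∂μ.1.toMeasure)
          - Real.log (⨆ ν : Q, ∫ x, Real.exp (φ x) ∂ν.1.toMeasure) : ℝ) : EReal)) φ).trans_lt hC1
      rw [EReal.coe_lt_coe_iff] at h1
      have h2 := le_ciSup (hbP φ) ⟨μ, hμ⟩
      have hS : 0 < ⨆ ν : Q, ∫ x, Real.exp (φ x) ∂ν.1.toMeasure :=
        (hexpos φ (Classical.arbitrary Q).1).trans_le (le_ciSup (hbQ φ) (Classical.arbitrary Q))
      have h3 : Real.exp (∫ x, φ x ∂μ.toMeasure - C) <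
          ⨆ ν : Q, ∫ x, Real.exp (φ x) ∂ν.1.toMeasure := by
        rw [← Real.lt_log_iff_exp_lt hS]
        simp only at h2
        linarith
      obtain ⟨ν, hν⟩ := exists_lt_of_lt_ciSup h3
      exact ⟨ν.1, ν.2, hν.le⟩)
    have h4 := dv_ge μ.toMeasure ν.toMeasure C' hall
    exact absurd (hC2'.trans_le (iInf₂_le ν hν)) (not_lt.2 h4)
  · refine iSup_le fun φ => ?_
    have h1 : ∀ μ ∈ P, ((∫ x, φ x ∂μ.toMeasure -
        Real.log (⨆ ν : Q, ∫ x, Real.exp (φ x) ∂ν.1.toMeasure) : ℝ) : EReal) ≤ genKL P Q := by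
      intro μ hμ
      refine le_trans (le_iInf₂ fun ν hν => ?_)
        (le_iSup₂ (f := fun (μ : ProbabilityMeasure X) (_ : μ ∈ P) =>
          ⨅ ν ∈ Q, klDiv μ.toMeasure ν.toMeasure) μ hμ)
      refine le_trans ?_ (dv_le μ.toMeasure ν.toMeasure φ (hexi φ ν))
      rw [EReal.coe_le_coe_iff]
      have := Real.log_le_log (hexpos φ ν) (le_ciSup (hbQ φ) ⟨ν, hν⟩)
      linarith
    induction hg : genKL P Q using EReal.rec with
    | bot =>
      obtain ⟨μ, hμ⟩ := hPne
      have := h1 μ hμ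
      rw [hg] at this
      exact absurd this (not_le.2 (EReal.bot_lt_coe _))
    | top => exact le_top
    | coe r =>
      rw [EReal.coe_le_coe_iff, sub_le_iff_le_add]
      refine ciSup_le fun μ => ?_
      have := h1 μ.1 μ.2
      rw [hg, EReal.coe_le_coe_iff] at this
      linarith
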